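/- Let X be a set of 11 distinct points of P^2 with generic Hilbert function. If H_{2X}(6) = 28, then H_{2X}(7) ≥ 31, H_{2X}(8) ≥ 32, and H_{2X}(9) ≥ 33. -/

import Mathlib

open MvPolynomial

/-- The vanishing (prime) ideal of a point of ℙ²: the ideal generated by the
linear forms vanishing at the point. -/
noncomputable def pointIdeal (k : Type) [Field k] (P : Projectivization k (Fin 3 → k)) :
    Ideal (MvPolynomial (Fin 3) k) :=
  Ideal.span {f : MvPolynomial (Fin 3) k | f.IsHomogeneous 1 ∧ eval P.rep f = 0}

/-- The Hilbert function of R/I: H(t) = dim_k R_t − dim_k I_t. -/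
noncomputable def hilbertFunction (k : Type) [Field k]
    (I : Ideal (MvPolynomial (Fin 3) k)) (t : ℕ) : ℕ :=
  Module.finrank k ↥(homogeneousSubmodule (Fin 3) k t) -
    Module.finrank k ↥(Submodule.restrictScalars k I ⊓ homogeneousSubmodule (Fin 3) k t)

/-- The defining ideal `I_X` of a finite set of points. -/
noncomputable def idealOfPoints (k : Type) [Field k] {s : ℕ}
    (P : Fin s → Projectivization k (Fin 3 → k)) : Ideal (MvPolynomial (Fin 3) k) :=
  ⨅ i, pointIdeal k (P i)

/-- The defining ideal `I_{2X}` of the double point scheme supported on a finite set of points. -/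
noncomputable def doubleIdealOfPoints (k : Type) [Field k] {s : ℕ}
    (P : Fin s → Projectivization k (Fin 3 → k)) : Ideal (MvPolynomial (Fin 3) k) :=
  ⨅ i, (pointIdeal k (P i)) ^ 2

/-- `X` has generic Hilbert function: `H_X(t) = min {s, binom(t+2,2)}` for all `t`. -/
def HasGenericHilbertFunction (k : Type) [Field k] {s : ℕ}
    (P : Fin s → Projectivization k (Fin 3 → k)) : Prop :=
  ∀ t : ℕ, hilbertFunction k (idealOfPoints k P) t = min s (Nat.choose (t + 2) 2)

/-- The directional derivative of a ternary form at `p` along `v`. -/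
noncomputable def dirDeriv {k : Type} [Field k] (v p : Fin 3 → k) :
    MvPolynomial (Fin 3) k →ₗ[k] k :=
  ∑ a, v a • ((aeval p : MvPolynomial (Fin 3) k →ₐ[k] k).toLinearMap ∘ₗ (pderiv a).toLinearMap)

/-- The linear form with coefficient vector `a`. -/
noncomputable def linForm {k : Type} [Field k] (a : Fin 3 → k) : MvPolynomial (Fin 3) k :=
  ∑ b, C (a b) * X b

/-- `F` is singular at `p`: it vanishes there together with all its directional derivatives. -/
def SingularAt {k : Type} [Field k] (p : Fin 3 → k) (F : MvPolynomial (Fin 3) k) : Prop :=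
  eval p F = 0 ∧ ∀ v, dirDeriv v p F = 0

section Derivatives

variable {k : Type} [Field k] {p v : Fin 3 → k} {F G : MvPolynomial (Fin 3) k}

lemma dirDeriv_apply (v p : Fin 3 → k) (F : MvPolynomial (Fin 3) k) :
    dirDeriv v p F = ∑ a, v a * eval p (pderiv a F) := by
  simp [dirDeriv]

lemma dirDeriv_mul (v p : Fin 3 → k) (F G : MvPolynomial (Fin 3) k) :
    dirDeriv v p (F * G) = eval p F * dirDeriv v p G + eval p G * dirDeriv v p F := by
  simp only [dirDeriv_apply, Derivation.leibniz, smul_eq_mul, map_add, map_mul, Finset.mul_sum,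
    ← Finset.sum_add_distrib]
  exact Finset.sum_congr rfl fun _ _ => by ring

lemma dirDeriv_single (a : Fin 3) (p : Fin 3 → k) (F : MvPolynomial (Fin 3) k) :
    dirDeriv (Pi.single a 1) p F = eval p (pderiv a F) := by
  simp [dirDeriv_apply, Pi.single_apply]

lemma dirDeriv_zero_left (p : Fin 3 → k) (F : MvPolynomial (Fin 3) k) :
    dirDeriv 0 p F = 0 := by
  simp [dirDeriv_apply]

lemma dirDeriv_add_left (u v p : Fin 3 → k) (F : MvPolynomial (Fin 3) k) :
    dirDeriv (u + v) p F = dirDeriv u p F + dirDeriv v p F := by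
  simp [dirDeriv_apply, add_mul, Finset.sum_add_distrib]

lemma dirDeriv_smul_left (c : k) (v p : Fin 3 → k) (F : MvPolynomial (Fin 3) k) :
    dirDeriv (c • v) p F = c * dirDeriv v p F := by
  simp [dirDeriv_apply, mul_assoc, Finset.mul_sum]

/-- Euler's identity at a point. -/
lemma dirDeriv_self {t : ℕ} (hF : F.IsHomogeneous t) (p : Fin 3 → k) :
    dirDeriv p p F = t * eval p F := by
  have := congrArg (eval p) hF.sum_X_mul_pderiv
  simpa [dirDeriv_apply] using this

lemma linForm_isHomogeneous (a : Fin 3 → k) : (linForm a).IsHomogeneous 1 :=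
  IsHomogeneous.sum _ _ _ fun b _ => isHomogeneous_C_mul_X (a b) b

@[simp] lemma eval_linForm (a p : Fin 3 → k) : eval p (linForm a) = a ⬝ᵥ p := by
  simp [linForm, dotProduct]

lemma dirDeriv_linForm (v p a : Fin 3 → k) : dirDeriv v p (linForm a) = a ⬝ᵥ v := by
  simp only [dirDeriv_apply, linForm, dotProduct, Fin.sum_univ_three, map_add, Derivation.leibniz,
    pderiv_C, pderiv_X]
  simp [mul_comm]

lemma linForm_add (a b : Fin 3 → k) : linForm (a + b) = linForm a + linForm b := by
  simp [linForm, add_mul, Finset.sum_add_distrib]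

lemma linForm_smul (c : k) (a : Fin 3 → k) : linForm (c • a) = c • linForm a := by
  simp [linForm, Finset.smul_sum, smul_eq_C_mul, mul_assoc]

lemma linForm_ne_zero {a : Fin 3 → k} (ha : a ≠ 0) : linForm a ≠ 0 := by
  intro h
  refine ha (dotProduct_eq_zero _ fun w => ?_)
  rw [← eval_linForm, h, map_zero]

namespace SingularAt

lemma mul_of_eval (hF : eval p F = 0) (hG : eval p G = 0) : SingularAt p (F * G) :=
  ⟨by simp [hF], fun v => by simp [dirDeriv_mul, hF, hG]⟩

lemma mul_right (hF : SingularAt p F) (G : MvPolynomial (Fin 3) k) : SingularAt p (F * G) :=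
  ⟨by simp [hF.1], fun v => by simp [dirDeriv_mul, hF.1, hF.2 v]⟩

lemma mul_left (hF : SingularAt p F) (G : MvPolynomial (Fin 3) k) : SingularAt p (G * F) :=
  mul_comm F G ▸ hF.mul_right G

lemma of_mul_left (hG : eval p G ≠ 0) (h : SingularAt p (G * F)) : SingularAt p F := by
  have h1 : eval p F = 0 := by simpa [hG] using h.1
  exact ⟨h1, fun v => by simpa [dirDeriv_mul, h1, hG] using h.2 v⟩

lemma of_eval_pderiv [CharZero k] {t : ℕ} (ht : t ≠ 0) (hF : F.IsHomogeneous t)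
    (h : ∀ v, dirDeriv v p F = 0) : SingularAt p F := by
  refine ⟨?_, h⟩
  have := dirDeriv_self hF p
  rw [h p] at this
  simpa [ht] using this.symm

end SingularAt

end Derivatives

section PointIdeals

variable {k : Type} [Field k]

lemma aeval_C_mul_of_isHomogeneous {t : ℕ} {F : MvPolynomial (Fin 3) k} (hF : F.IsHomogeneous t)
    (c : MvPolynomial (Fin 3) k) (g : Fin 3 → MvPolynomial (Fin 3) k) :
    aeval (fun b => c * g b) F = c ^ t * aeval g F := by
  rw [aeval_def, aeval_def, eval₂_eq', eval₂_eq', Finset.mul_sum]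
  refine Finset.sum_congr rfl fun d hd => ?_
  have : ∑ i, d i = t := by
    rw [hF.degree_eq_sum_deg_support hd]
    exact (Finset.sum_subset (Finset.subset_univ _) (by simp)).symm
  simp only [mul_pow, Finset.prod_mul_distrib, Finset.prod_pow_eq_pow_sum, this]
  ring

lemma aeval_C_point (p : Fin 3 → k) (F : MvPolynomial (Fin 3) k) :
    aeval (fun b => (C (p b) : MvPolynomial (Fin 3) k)) F = C (eval p F) := by
  induction F using MvPolynomial.induction_on with
  | C a => simp [algebraMap_eq]
  | add f g hf hg => rw [map_add, hf, hg, map_add, C_add]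
  | mul_X f i hf => rw [map_mul, hf, aeval_X, map_mul, eval_X, C_mul]

/-- First-order Taylor expansion modulo the square of an ideal containing the increments. -/
lemma taylor_mem_sq (I : Ideal (MvPolynomial (Fin 3) k)) (u w : Fin 3 → MvPolynomial (Fin 3) k)
    (hw : ∀ b, w b ∈ I) (F : MvPolynomial (Fin 3) k) :
    aeval (fun b => u b + w b) F - aeval u F - ∑ b, aeval u (pderiv b F) * w b ∈ I ^ 2 := by
  induction F using MvPolynomial.induction_on with
  | C a => simp
  | add f g hf hg =>
    convert add_mem hf hg using 1
    simp only [map_add, add_mul, Finset.sum_add_distrib]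
    ring
  | mul_X f i hf =>
    have h2 : (∑ b, aeval u (pderiv b f) * w b) * w i ∈ I ^ 2 := by
      rw [pow_two]
      exact Ideal.mul_mem_mul (Ideal.sum_mem _ fun b _ => Ideal.mul_mem_left _ _ (hw b)) (hw i)
    convert add_mem (Ideal.mul_mem_right (u i + w i) _ hf) h2 using 1
    have h3 : ∑ b, aeval u (pderiv b (f * X i)) * w b =
        aeval u f * w i + u i * ∑ b, aeval u (pderiv b f) * w b := by
      simp only [Derivation.leibniz, smul_eq_mul, map_add, map_mul, aeval_X, pderiv_X, add_mul,
        Finset.sum_add_distrib, Finset.mul_sum]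
      congr 1
      · rw [Finset.sum_eq_single i]
        · simp
        · intro b _ hb
          simp [hb.symm]
        · simp
      · exact Finset.sum_congr rfl fun _ _ => by ring
    rw [h3]
    simp only [map_mul, aeval_X]
    ring

lemma eval_eq_zero_of_mem_pointIdeal {P : Projectivization k (Fin 3 → k)}
    {F : MvPolynomial (Fin 3) k} (hF : F ∈ pointIdeal k P) : eval P.rep F = 0 := by
  have : pointIdeal k P ≤ RingHom.ker (eval P.rep) := by
    rw [pointIdeal, Ideal.span_le]
    exact fun f hf => hf.2
  exact this hF

lemma singularAt_of_mem_sq {P : Projectivization k (Fin 3 → k)}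
    {F : MvPolynomial (Fin 3) k} (hF : F ∈ pointIdeal k P ^ 2) : SingularAt P.rep F := by
  rw [pow_two] at hF
  refine Submodule.mul_induction_on hF (fun f hf g hg => ?_) fun f g hf hg => ?_
  · exact .mul_of_eval (eval_eq_zero_of_mem_pointIdeal hf) (eval_eq_zero_of_mem_pointIdeal hg)
  · exact ⟨by simp [hf.1, hg.1], fun v => by simp [hf.2 v, hg.2 v]⟩

/-- Modulo the square of the ideal of `p`, a form is determined by its value and derivatives at
`p`. -/
lemma exists_taylor (P : Projectivization k (Fin 3 → k)) {t : ℕ} {F : MvPolynomial (Fin 3) k}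
    (hF : F.IsHomogeneous t) :
    ∃ c : k, c ≠ 0 ∧ ∃ (m : MvPolynomial (Fin 3) k) (g : Fin 3 → MvPolynomial (Fin 3) k),
      (∀ b, g b ∈ pointIdeal k P) ∧
      C c * F - m * C (eval P.rep F) - ∑ b, C (eval P.rep (pderiv b F)) * g b ∈
        pointIdeal k P ^ 2 := by
  obtain ⟨a, ha⟩ := Function.ne_iff.mp P.rep_nonzero
  set p := P.rep with hp
  have hw : ∀ b, C (p a) * X b - X a * C (p b) ∈ pointIdeal k P := fun b => by
    refine Ideal.subset_span ⟨?_, ?_⟩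
    · rw [mul_comm (X a)]
      exact (isHomogeneous_C_mul_X _ _).sub (isHomogeneous_C_mul_X _ _)
    · simp [← hp, mul_comm]
  have key := taylor_mem_sq _ (fun b => X a * C (p b)) _ hw F
  have h1 : aeval (fun b => X a * C (p b) + (C (p a) * X b - X a * C (p b))) F
      = C (p a ^ t) * F := by
    simp only [add_sub_cancel]
    rw [aeval_C_mul_of_isHomogeneous hF]
    simp
  rw [h1, aeval_C_mul_of_isHomogeneous hF, aeval_C_point] at key
  refine ⟨p a ^ t, pow_ne_zero _ ha, X a ^ t,
    fun b => X a ^ (t - 1) * (C (p a) * X b - X a * C (p b)),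
    fun b => Ideal.mul_mem_left _ _ (hw b), ?_⟩
  convert key using 2
  refine Finset.sum_congr rfl fun b _ => ?_
  rw [aeval_C_mul_of_isHomogeneous (hF.pderiv), aeval_C_point]
  ring

lemma mem_of_C_mul_mem {I : Ideal (MvPolynomial (Fin 3) k)} {c : k} (hc : c ≠ 0)
    {F : MvPolynomial (Fin 3) k} (h : C c * F ∈ I) : F ∈ I := by
  have := Ideal.mul_mem_left I (C c⁻¹) h
  rwa [← mul_assoc, ← C_mul, inv_mul_cancel₀ hc, C_1, one_mul] at this

lemma mem_pointIdeal_of_eval {P : Projectivization k (Fin 3 → k)} {t : ℕ}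
    {F : MvPolynomial (Fin 3) k} (hF : F.IsHomogeneous t) (h : eval P.rep F = 0) :
    F ∈ pointIdeal k P := by
  obtain ⟨c, hc, m, g, hg, hmem⟩ := exists_taylor P hF
  refine mem_of_C_mul_mem hc ?_
  have h1 := Ideal.pow_le_self two_ne_zero hmem
  have h2 := add_mem h1 (Ideal.sum_mem _ fun b (_ : b ∈ Finset.univ) =>
    Ideal.mul_mem_left _ (C (eval P.rep (pderiv b F))) (hg b))
  simpa [h] using h2

lemma mem_sq_of_singularAt {P : Projectivization k (Fin 3 → k)} {t : ℕ}
    {F : MvPolynomial (Fin 3) k} (hF : F.IsHomogeneous t) (h : SingularAt P.rep F) :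
    F ∈ pointIdeal k P ^ 2 := by
  obtain ⟨c, hc, m, g, hg, hmem⟩ := exists_taylor P hF
  refine mem_of_C_mul_mem hc ?_
  simpa [h.1, ← dirDeriv_single, h.2] using hmem

end PointIdeals

section Dimensions

variable {k : Type} [Field k]

instance finiteDimensional_homogeneousSubmodule (t : ℕ) :
    FiniteDimensional k (homogeneousSubmodule (Fin 3) k t) :=
  Module.Finite.iff_fg.mpr (homogeneousSubmodule_fg (Fin 3) k t)

lemma finrank_homogeneousSubmodule (t : ℕ) :
    Module.finrank k (homogeneousSubmodule (Fin 3) k t) = (t + 2).choose 2 := by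
  have hset : {d : Fin 3 →₀ ℕ | d.degree = t} =
      ((Finset.univ : Finset (Fin 3)).finsuppAntidiag t : Set (Fin 3 →₀ ℕ)) := by
    ext d
    simp [Finsupp.degree_eq_sum]
  have hcard : ((Finset.univ : Finset (Fin 3)).finsuppAntidiag t).card = (t + 2).choose 2 := by
    rw [Finset.card_finsuppAntidiag_nat_eq_choose, Finset.card_univ, Fintype.card_fin,
      show 3 + t - 1 = t + 2 by omega, ← Nat.choose_symm_add]
  have hb := (MvPolynomial.basisMonomials (Fin 3) k).linearIndependent.comp
    (Subtype.val : ((Finset.univ : Finset (Fin 3)).finsuppAntidiag t) → _) Subtype.val_injective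
  have hspan : Submodule.span k (Set.range ((MvPolynomial.basisMonomials (Fin 3) k) ∘
      (Subtype.val : ((Finset.univ : Finset (Fin 3)).finsuppAntidiag t) → _))) =
      homogeneousSubmodule (Fin 3) k t := by
    rw [homogeneousSubmodule_eq_finsupp_supported, hset, AddMonoidAlgebra.supported_eq_span_single,
      Set.range_comp, Subtype.range_coe_subtype]
    rfl
  rw [← hspan, finrank_span_eq_card hb, Fintype.card_coe, hcard]

lemma finrank_ker_dual {M ι : Type} [AddCommGroup M] [Module k M] [FiniteDimensional k M]
    [Fintype ι] [DecidableEq ι] (Φ : M →ₗ[k] ι → k) :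
    Module.finrank k (LinearMap.ker (Φ.dualMap ∘ₗ (dotProductEquiv k ι).toLinearMap)) +
      Module.finrank k M = Fintype.card ι + Module.finrank k (LinearMap.ker Φ) := by
  have h1 := LinearMap.finrank_range_add_finrank_ker
    (Φ.dualMap ∘ₗ (dotProductEquiv k ι).toLinearMap)
  have h2 := LinearMap.finrank_range_add_finrank_ker Φ
  rw [LinearMap.range_comp_of_range_eq_top _ (dotProductEquiv k ι).range,
    LinearMap.finrank_range_dualMap_eq_finrank_range, Module.finrank_fintype_fun_eq_card] at h1
  omega

/-- The forms of degree `t` that are singular at all the points `p i`. -/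
noncomputable def singularForms {s : ℕ} (p : Fin s → Fin 3 → k) (t : ℕ) :
    Submodule k (MvPolynomial (Fin 3) k) where
  carrier := {F | F.IsHomogeneous t ∧ ∀ i, SingularAt (p i) F}
  add_mem' hF hG := ⟨hF.1.add hG.1, fun i =>
    ⟨by simp [(hF.2 i).1, (hG.2 i).1], fun v => by simp [(hF.2 i).2, (hG.2 i).2]⟩⟩
  zero_mem' := ⟨isHomogeneous_zero _ _ _, fun i => ⟨map_zero _, fun _ => map_zero _⟩⟩
  smul_mem' c F hF := ⟨Submodule.smul_mem (homogeneousSubmodule (Fin 3) k t) c hF.1, fun i =>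
    ⟨by simp [(hF.2 i).1], fun v => by simp [(hF.2 i).2]⟩⟩

lemma mem_singularForms {s : ℕ} {p : Fin s → Fin 3 → k} {t : ℕ} {F : MvPolynomial (Fin 3) k} :
    F ∈ singularForms p t ↔ F.IsHomogeneous t ∧ ∀ i, SingularAt (p i) F := Iff.rfl

instance finiteDimensional_singularForms {s : ℕ} (p : Fin s → Fin 3 → k) (t : ℕ) :
    FiniteDimensional k (singularForms p t) :=
  Submodule.finiteDimensional_of_le
    (show singularForms p t ≤ homogeneousSubmodule (Fin 3) k t from fun _ hF => hF.1)

/-- The linear relations satisfied by the gradients at the points `p i` of all forms of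
degree `t`. -/
noncomputable def relations {s : ℕ} (p : Fin s → Fin 3 → k) (t : ℕ) :
    Submodule k (Fin s × Fin 3 → k) where
  carrier := {v | ∀ F : MvPolynomial (Fin 3) k, F.IsHomogeneous t →
    ∑ i, dirDeriv (Function.curry v i) (p i) F = 0}
  add_mem' {u v} hu hv F hF := by
    have : ∀ i, Function.curry (u + v) i = Function.curry u i + Function.curry v i := fun _ => rfl
    simp [this, dirDeriv_add_left, Finset.sum_add_distrib, hu F hF, hv F hF]
  zero_mem' F _ := Finset.sum_eq_zero fun i _ => dirDeriv_zero_left _ F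
  smul_mem' c v hv F hF := by
    have : ∀ i, Function.curry (c • v) i = c • Function.curry v i := fun _ => rfl
    simp [this, dirDeriv_smul_left, ← Finset.mul_sum, hv F hF]

lemma mem_relations {s : ℕ} {p : Fin s → Fin 3 → k} {t : ℕ} {v : Fin s × Fin 3 → k} :
    v ∈ relations p t ↔ ∀ F : MvPolynomial (Fin 3) k, F.IsHomogeneous t →
      ∑ i, dirDeriv (Function.curry v i) (p i) F = 0 := Iff.rfl

lemma finrank_relations [CharZero k] {s : ℕ} (p : Fin s → Fin 3 → k) {t : ℕ} (ht : t ≠ 0) :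
    Module.finrank k (relations p t) + (t + 2).choose 2 =
      3 * s + Module.finrank k (singularForms p t) := by
  let Φ : homogeneousSubmodule (Fin 3) k t →ₗ[k] (Fin s × Fin 3 → k) :=
    LinearMap.pi fun x => (dirDeriv (Pi.single x.2 1) (p x.1)).domRestrict _
  have hΦ : ∀ F x, Φ F x = eval (p x.1) (pderiv x.2 F.1) := fun F x => dirDeriv_single _ _ _
  have key := finrank_ker_dual Φ
  have h1 : LinearMap.ker (Φ.dualMap ∘ₗ (dotProductEquiv k (Fin s × Fin 3)).toLinearMap) =
      relations p t := by
    ext v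
    rw [LinearMap.mem_ker, LinearMap.ext_iff, mem_relations, Subtype.forall]
    refine forall₂_congr fun F hF => ?_
    simp [dotProduct, hΦ, Fintype.sum_prod_type, dirDeriv_apply]
  have h2 : (LinearMap.ker Φ).map (homogeneousSubmodule (Fin 3) k t).subtype =
      singularForms p t := by
    ext F
    rw [Submodule.mem_map, mem_singularForms]
    constructor
    · rintro ⟨F, hF, rfl⟩
      refine ⟨F.2, fun i => .of_eval_pderiv ht F.2 fun v => ?_⟩
      rw [dirDeriv_apply]
      refine Finset.sum_eq_zero fun a _ => ?_
      have := congrFun (LinearMap.mem_ker.mp hF) (i, a)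
      rw [hΦ] at this
      simp [this]
    · rintro ⟨hF, h⟩
      exact ⟨⟨F, hF⟩, LinearMap.mem_ker.mpr (funext fun x => (h x.1).2 _), rfl⟩
  rw [h1, finrank_homogeneousSubmodule, Fintype.card_prod, Fintype.card_fin, Fintype.card_fin,
    LinearEquiv.finrank_eq (Submodule.equivMapOfInjective _
      (Submodule.subtype_injective _) (LinearMap.ker Φ)), h2] at key
  omega

end Dimensions

section Division

variable {k : Type} [Field k]

attribute [local instance] MvPolynomial.gradedAlgebra in
lemma exists_isHomogeneous_of_dvd {t : ℕ} {F : MvPolynomial (Fin 3) k}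
    (hF : F.IsHomogeneous (1 + t)) {a : Fin 3 → k} (h : linForm a ∣ F) :
    ∃ G : MvPolynomial (Fin 3) k, G.IsHomogeneous t ∧ F = linForm a * G := by
  obtain ⟨G, rfl⟩ := h
  have := DirectSum.coe_decompose_mul_add_of_left_mem (homogeneousSubmodule (Fin 3) k) (j := t)
    (b := G) (linForm_isHomogeneous a)
  rw [DirectSum.decompose_of_mem_same _ hF] at this
  exact ⟨_, (mem_homogeneousSubmodule t _).mp (SetLike.coe_mem _), this⟩

lemma irreducible_linForm {a : Fin 3 → k} (ha : a ≠ 0) : Irreducible (linForm a) := by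
  refine irreducible_of_totalDegree_eq_one
    ((linForm_isHomogeneous a).totalDegree (linForm_ne_zero ha)) fun x hx => ?_
  obtain ⟨i, hi⟩ := Function.ne_iff.mp ha
  refine isUnit_of_dvd_unit (?_ : x ∣ a i) (isUnit_iff_ne_zero.mpr hi)
  have : coeff (Finsupp.single i 1) (linForm a) = a i := by
    simp [linForm, coeff_sum, coeff_C_mul, coeff_X, Finsupp.single_left_inj]
  exact this ▸ hx (Finsupp.single i 1)

lemma linForm_dvd_of_mul_eq {a b w : Fin 3 → k} (haw : a ⬝ᵥ w = 0) (hbw : b ⬝ᵥ w ≠ 0)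
    (ha : a ≠ 0) {F G : MvPolynomial (Fin 3) k} (h : linForm b * F = linForm a * G) :
    linForm a ∣ F := by
  refine ((irreducible_linForm ha).prime.dvd_or_dvd ⟨G, h⟩).resolve_left fun ⟨H, hH⟩ => hbw ?_
  simpa [haw] using congrArg (eval w) hH

end Division

section Growth

variable {k : Type} [Field k]

lemma exists_complementary_linForms {a : Fin 3 → k} (ha : a ≠ 0) :
    ∃ b₁ b₂ w₁ w₂ : Fin 3 → k, a ⬝ᵥ w₁ = 0 ∧ a ⬝ᵥ w₂ = 0 ∧ b₁ ⬝ᵥ w₁ ≠ 0 ∧ b₁ ⬝ᵥ w₂ = 0 ∧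
      b₂ ⬝ᵥ w₂ ≠ 0 := by
  obtain ⟨c, hc⟩ := Function.ne_iff.mp ha
  refine ⟨Pi.single (c + 1) 1, Pi.single (c + 2) 1,
    Pi.single (c + 1) (a c) - Pi.single c (a (c + 1)),
    Pi.single (c + 2) (a c) - Pi.single c (a (c + 2)), ?_⟩
  have hc' : a c ≠ 0 := hc
  simp [dotProduct_sub, mul_comm, hc']

/-- Multiplication of singular forms by a linear form. -/
noncomputable def mulLinForm {s : ℕ} (p : Fin s → Fin 3 → k) (t : ℕ) (a : Fin 3 → k) :
    singularForms p t →ₗ[k] singularForms p (1 + t) :=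
  (LinearMap.mulLeft k (linForm a)).restrict fun _ hF =>
    ⟨(linForm_isHomogeneous a).mul hF.1, fun i => (hF.2 i).mul_left _⟩

lemma coe_mulLinForm {s : ℕ} (p : Fin s → Fin 3 → k) (t : ℕ) (a : Fin 3 → k)
    (F : singularForms p t) : (mulLinForm p t a F : MvPolynomial (Fin 3) k) = linForm a * F := rfl

lemma exists_dotProduct_ne_zero [Infinite k] {s : ℕ} {p : Fin s → Fin 3 → k}
    (hp : ∀ i, p i ≠ 0) : ∃ a : Fin 3 → k, ∀ i, a ⬝ᵥ p i ≠ 0 := by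
  obtain ⟨f, hf⟩ := Module.exists_dual_forall_apply_ne_zero (K := k) p hp
  obtain ⟨a, rfl⟩ := (dotProductEquiv k (Fin 3)).surjective f
  exact ⟨a, hf⟩

/-- If no form of degree `t` is singular at the points, a nonzero space of singular forms of
degree `t + 1` more than doubles in degree `t + 2`. -/
lemma two_mul_finrank_singularForms_lt [IsAlgClosed k] {s : ℕ} [NeZero s]
    {p : Fin s → Fin 3 → k} (hp : ∀ i, p i ≠ 0) {t : ℕ} (h0 : singularForms p t = ⊥)
    (h1 : singularForms p (1 + t) ≠ ⊥) :
    2 * Module.finrank k (singularForms p (1 + t)) <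
      Module.finrank k (singularForms p (1 + (1 + t))) := by
  have : Infinite k := IsAlgClosed.instInfinite
  obtain ⟨a, ha⟩ := exists_dotProduct_ne_zero hp
  have ha0 : a ≠ 0 := fun h => ha 0 (by simp [h])
  obtain ⟨b₁, b₂, w₁, w₂, haw₁, haw₂, hb₁, hb₁₂, hb₂⟩ := exists_complementary_linForms ha0
  have hdvd : ∀ b w : Fin 3 → k, a ⬝ᵥ w = 0 → b ⬝ᵥ w ≠ 0 → ∀ F G : singularForms p (1 + t),
      linForm b * (F : MvPolynomial (Fin 3) k) = linForm a * G → F = 0 := by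
    intro b w haw hbw F G hFG
    obtain ⟨H, hH, hF⟩ := exists_isHomogeneous_of_dvd F.2.1
      (linForm_dvd_of_mul_eq haw hbw ha0 hFG)
    have hmem : H ∈ singularForms p t :=
      ⟨hH, fun i => .of_mul_left (by simpa using ha i) (hF ▸ F.2.2 i)⟩
    rw [h0, Submodule.mem_bot] at hmem
    exact Subtype.ext (by rw [hF, hmem, mul_zero]; rfl)
  let Ψ := (mulLinForm p (1 + t) b₁).coprod (mulLinForm p (1 + t) a)
  have hinj : Function.Injective Ψ := by
    rw [← LinearMap.ker_eq_bot, LinearMap.ker_eq_bot']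
    rintro ⟨F, G⟩ hFG
    have h := congrArg Subtype.val hFG
    simp only [Ψ, LinearMap.coprod_apply, Submodule.coe_add, coe_mulLinForm,
      Submodule.coe_zero] at h
    have hF : F = 0 := hdvd b₁ w₁ haw₁ hb₁ F (-G) (by
      rw [Submodule.coe_neg, mul_neg]
      exact eq_neg_of_add_eq_zero_left h)
    subst hF
    have hG : linForm a * (G : MvPolynomial (Fin 3) k) = 0 := by simpa using h
    have hG' : G = 0 := Subtype.ext ((mul_eq_zero.mp hG).resolve_left (linForm_ne_zero ha0))
    rw [hG']
    rfl
  have hle := LinearMap.finrank_le_finrank_of_injective hinj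
  rw [Module.finrank_prod, ← two_mul] at hle
  refine lt_of_le_of_ne hle fun heq => ?_
  let e := LinearEquiv.ofInjectiveOfFinrankEq Ψ hinj (by rw [Module.finrank_prod, ← two_mul, heq])
  have he : ∀ x, e x = Ψ x := fun x => rfl
  let T : Module.End k (singularForms p (1 + t)) :=
    LinearMap.fst k _ _ ∘ₗ e.symm.toLinearMap ∘ₗ mulLinForm p (1 + t) b₂
  have : Nontrivial (singularForms p (1 + t)) := (Submodule.nontrivial_iff_ne_bot).mpr h1
  obtain ⟨μ, hμ⟩ := Module.End.exists_eigenvalue T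
  obtain ⟨F, hF⟩ := hμ.exists_hasEigenvector
  have hTF : (e.symm (mulLinForm p (1 + t) b₂ F)).1 = μ • F := hF.apply_eq_smul
  have hdec := congrArg Subtype.val (e.apply_symm_apply (mulLinForm p (1 + t) b₂ F))
  rw [he, LinearMap.coprod_apply, hTF] at hdec
  simp only [Submodule.coe_add, coe_mulLinForm, Submodule.coe_smul] at hdec
  refine hF.2 (hdvd (b₂ + (-μ) • b₁) w₂ haw₂ (by simpa [add_dotProduct, hb₁₂] using hb₂) F
    (e.symm (mulLinForm p (1 + t) b₂ F)).2 ?_)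
  rw [linForm_add, linForm_smul, add_mul, ← hdec, mul_smul_comm, smul_mul_assoc, neg_smul]
  ring

end Growth

section Relations

variable {k : Type} [Field k] {s : ℕ} {p : Fin s → Fin 3 → k}

lemma dirDeriv_eq_zero_of_mem_relations {t : ℕ} {v : Fin s × Fin 3 → k} (hv : v ∈ relations p t)
    (i : Fin s) {F : MvPolynomial (Fin 3) k} (hF : F.IsHomogeneous t)
    (h : ∀ j ≠ i, Function.curry v j = 0 ∨ SingularAt (p j) F) :
    dirDeriv (Function.curry v i) (p i) F = 0 := by
  rw [← hv F hF, Finset.sum_eq_single i (fun j _ hj => ?_) (by simp)]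
  rcases h j hj with h | h
  · rw [h, dirDeriv_zero_left]
  · exact h.2 _

/-- A relation vanishes at `p i` if some form of degree one less is singular at the rest of its
support, but does not vanish at `p i`. -/
lemma curry_eq_zero_of_mem_relations [CharZero k] {t : ℕ} {v : Fin s × Fin 3 → k}
    (hv : v ∈ relations p (t + 1)) (i : Fin s) {g : MvPolynomial (Fin 3) k}
    (hg : g.IsHomogeneous t) (hgi : eval (p i) g ≠ 0)
    (h : ∀ j ≠ i, Function.curry v j = 0 ∨ SingularAt (p j) g) : Function.curry v i = 0 := by
  set u := Function.curry v i with hu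
  set κ := dirDeriv u (p i) g / eval (p i) g with hκ
  have hm : ∀ m : Fin 3 → k, (u + κ • p i) ⬝ᵥ m = 0 := fun m => by
    have h1 := dirDeriv_eq_zero_of_mem_relations hv i (hg.mul (linForm_isHomogeneous m))
      fun j hj => (h j hj).imp_right fun h => h.mul_right _
    rw [dirDeriv_mul, dirDeriv_linForm, eval_linForm, ← hu] at h1
    rw [dotProduct_comm, dotProduct_add, dotProduct_smul, smul_eq_mul, hκ]
    field_simp
    linear_combination h1
  have hu2 : u = (-κ) • p i := by
    rw [neg_smul]
    exact eq_neg_of_add_eq_zero_left (dotProduct_eq_zero _ hm)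
  have h2 : dirDeriv u (p i) g = -κ * (t * eval (p i) g) := by
    rw [hu2, dirDeriv_smul_left, dirDeriv_self hg]
  have h3 : κ * (t + 1) = 0 := by
    rw [h2] at hκ
    field_simp at hκ
    linear_combination hκ
  have h4 : κ = 0 := (mul_eq_zero.mp h3).resolve_right (by exact_mod_cast t.succ_ne_zero)
  rw [hu2, h4, neg_zero, zero_smul]

lemma exists_dotProduct_ne_zero_of_ne {x : Fin 3 → k} (hx : x ≠ 0) :
    ∃ n : Fin 3 → k, n ⬝ᵥ x ≠ 0 := by
  by_contra! h
  exact hx (dotProduct_eq_zero x fun w => by rw [dotProduct_comm, h])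

lemma exists_dotProduct_separating {x y : Fin 3 → k} (h : x ∉ Submodule.span k {y}) :
    ∃ m : Fin 3 → k, m ⬝ᵥ y = 0 ∧ m ⬝ᵥ x ≠ 0 := by
  obtain ⟨f, hf, hle⟩ := Submodule.exists_le_ker_of_notMem h
  obtain ⟨m, rfl⟩ := (dotProductEquiv k (Fin 3)).surjective f
  exact ⟨m, hle (Submodule.mem_span_singleton_self y), hf⟩

/-- Eleven points on no cubic: a tangent direction at one of them on which the quartics impose
no further condition comes from a line through five of the points. -/
lemma exists_line_of_tangent {p : Fin 11 → Fin 3 → k} (hp : ∀ i, p i ≠ 0)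
    (hsep : ∀ i j, i ≠ j → ∃ m : Fin 3 → k, m ⬝ᵥ p j = 0 ∧ m ⬝ᵥ p i ≠ 0)
    (hcub : ∀ F : MvPolynomial (Fin 3) k, F.IsHomogeneous 3 → (∀ i, eval (p i) F = 0) → F = 0)
    {o : Fin 11} {v b : Fin 3 → k} (hbo : b ⬝ᵥ p o = 0) (hbv : b ⬝ᵥ v ≠ 0) {c : Fin 11 → k}
    (hc : ∀ F : MvPolynomial (Fin 3) k, F.IsHomogeneous 4 →
      dirDeriv v (p o) F = ∑ i, c i * eval (p i) F) :
    ∃ a : Fin 3 → k, a ≠ 0 ∧ ∃ L : Finset (Fin 11), L.card = 5 ∧ ∀ i ∈ L, a ⬝ᵥ p i = 0 := by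
  classical
  let Φ : homogeneousSubmodule (Fin 3) k 3 →ₗ[k] (Option (Fin 11) → k) :=
    LinearMap.pi fun x => (x.elim (dirDeriv v (p o)) fun i =>
      (aeval (p i) : MvPolynomial (Fin 3) k →ₐ[k] k).toLinearMap).domRestrict _
  have hker : LinearMap.ker Φ = ⊥ := by
    refine LinearMap.ker_eq_bot'.mpr fun F hF => Subtype.ext (hcub F.1 F.2 fun i => ?_)
    simpa [Φ] using congrFun hF (some i)
  have hdim := finrank_ker_dual Φ
  rw [hker, finrank_homogeneousSubmodule, finrank_bot, Fintype.card_option, Fintype.card_fin]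
    at hdim
  set E := LinearMap.ker (Φ.dualMap ∘ₗ (dotProductEquiv k (Option (Fin 11))).toLinearMap) with hE
  let θ : (Fin 3 → k) →ₗ[k] (Option (Fin 11) → k) := LinearMap.pi fun x =>
    x.elim (dotProductEquiv k (Fin 3) (p o)) fun i =>
      (if i = o then dotProductEquiv k (Fin 3) v else 0) - c i • dotProductEquiv k (Fin 3) (p i)
  have hθ : ∀ a, θ a ∈ E := fun a => by
    rw [hE, LinearMap.mem_ker]
    refine LinearMap.ext fun G => ?_
    have h4 := hc _ ((linForm_isHomogeneous a).mul G.2)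
    simp only [dirDeriv_mul, dirDeriv_linForm, map_mul, eval_linForm] at h4
    have h5 : ∑ i, (θ a (some i)) * eval (p i) G.1 =
        (v ⬝ᵥ a) * eval (p o) G.1 - ∑ i, c i * ((a ⬝ᵥ p i) * eval (p i) G.1) := by
      simp only [θ, LinearMap.pi_apply, Option.elim_some, LinearMap.sub_apply, sub_mul,
        Finset.sum_sub_distrib]
      congr 1
      · rw [Finset.sum_eq_single o (fun i _ hi => by simp [hi]) (by simp)]
        simp
      · exact Finset.sum_congr rfl fun i _ => by simp [dotProduct_comm (p i), mul_assoc]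
    have h6 : (Φ.dualMap ∘ₗ (dotProductEquiv k (Option (Fin 11))).toLinearMap) (θ a) G =
        (p o ⬝ᵥ a) * dirDeriv v (p o) G.1 + ∑ i, (θ a (some i)) * eval (p i) G.1 := by
      simp [dotProduct, Fintype.sum_option, Φ, θ]
    rw [h6, h5, ← h4, dotProduct_comm (p o), dotProduct_comm v, LinearMap.zero_apply]
    ring
  have hE2 : Module.finrank k E = 2 := by
    norm_num [Nat.choose] at hdim
    omega
  obtain ⟨a, haker, ha0⟩ := Submodule.exists_mem_ne_zero_of_ne_bot
    (LinearMap.ker_ne_bot_of_finrank_lt (f := θ.codRestrict E hθ) (by simp [hE2]))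
  have hθa : ∀ x, θ a x = 0 := fun x =>
    congrFun (congrArg Subtype.val (LinearMap.mem_ker.mp haker)) x
  refine ⟨a, ha0, ?_⟩
  have hao : a ⬝ᵥ p o = 0 := by simpa [θ, dotProduct_comm] using hθa none
  have hac : ∀ i ≠ o, c i = 0 ∨ a ⬝ᵥ p i = 0 := fun i hi => by
    simpa [θ, hi, dotProduct_comm (p i)] using hθa (some i)
  by_contra! hL
  have hlt : (Finset.univ.filter fun i => a ⬝ᵥ p i = 0).card < 5 := by
    by_contra! h
    obtain ⟨L, hsub, hcard⟩ := Finset.exists_subset_card_eq h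
    obtain ⟨i, hi, hne⟩ := hL L hcard
    exact hne (by simpa using hsub hi)
  set S := (Finset.univ.filter fun i => a ⬝ᵥ p i = 0).erase o with hS
  have hScard : S.card ≤ 3 := by
    rw [hS, Finset.card_erase_of_mem (by simp [hao])]
    omega
  have hm : ∀ j, ∃ m : Fin 3 → k, j ≠ o → m ⬝ᵥ p j = 0 ∧ m ⬝ᵥ p o ≠ 0 := fun j => by
    by_cases h : j = o
    · exact ⟨0, fun h' => absurd h h'⟩
    · obtain ⟨m, hm⟩ := hsep o j (Ne.symm h)
      exact ⟨m, fun _ => hm⟩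
  choose m hm using hm
  obtain ⟨n, hn⟩ := exists_dotProduct_ne_zero_of_ne (hp o)
  set g := (∏ j ∈ S, linForm (m j)) * linForm n ^ (3 - S.card) with hg
  have hghom : (linForm b * g).IsHomogeneous 4 := by
    have h1 := IsHomogeneous.prod S (fun j => linForm (m j)) (fun _ => 1)
      fun j _ => linForm_isHomogeneous (m j)
    convert (linForm_isHomogeneous b).mul (h1.mul ((linForm_isHomogeneous n).pow (3 - S.card)))
      using 1
    simp
    omega
  have hgo : eval (p o) g ≠ 0 := by
    rw [hg, map_mul, map_prod, map_pow]
    refine mul_ne_zero (Finset.prod_ne_zero_iff.mpr fun j hj => ?_) (pow_ne_zero _ ?_)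
    · simpa using (hm j (Finset.ne_of_mem_erase hj)).2
    · simpa using hn
  have key := hc _ hghom
  rw [dirDeriv_mul, dirDeriv_linForm, eval_linForm, hbo, zero_mul, zero_add,
    Finset.sum_eq_zero] at key
  · exact mul_ne_zero hgo hbv key
  · intro i _
    by_cases hio : i = o
    · simp [hio, hbo]
    · rcases hac i hio with h | h
      · simp [h]
      · have hiS : i ∈ S := by simp [hS, hio, h]
        have : eval (p i) g = 0 := by
          rw [hg, map_mul, map_prod, Finset.prod_eq_zero hiS, zero_mul]
          simpa using (hm i hio).1
        simp [this]

end Relations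

/-- The properties of eleven points with generic Hilbert function used below: they are nonzero and
pairwise non-proportional, lie on no cubic, and are separated by quartics. -/
structure GeneralPoints {k : Type} [Field k] (p : Fin 11 → Fin 3 → k) : Prop where
  ne_zero : ∀ i, p i ≠ 0
  separated : ∀ i j, i ≠ j → ∃ m : Fin 3 → k, m ⬝ᵥ p j = 0 ∧ m ⬝ᵥ p i ≠ 0
  cubic : ∀ F : MvPolynomial (Fin 3) k, F.IsHomogeneous 3 → (∀ i, eval (p i) F = 0) → F = 0
  quartic : ∀ i, ∃ Q : MvPolynomial (Fin 3) k, Q.IsHomogeneous 4 ∧ eval (p i) Q ≠ 0 ∧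
    ∀ j ≠ i, eval (p j) Q = 0

lemma isHomogeneous_of_eq {σ R : Type*} [CommSemiring R] {F : MvPolynomial σ R} {m n : ℕ}
    (hF : F.IsHomogeneous m) (h : m = n) : F.IsHomogeneous n :=
  h ▸ hF

namespace GeneralPoints

variable {k : Type} [Field k] {p : Fin 11 → Fin 3 → k}

lemma eq_zero_of_curry {v : Fin 11 × Fin 3 → k} (h : ∀ i, Function.curry v i = 0) : v = 0 :=
  funext fun x => congrFun (h x.1) x.2

lemma relations_nine [CharZero k] (hp : GeneralPoints p) : relations p 9 = ⊥ := by
  refine (Submodule.eq_bot_iff _).mpr fun v hv => eq_zero_of_curry fun i => ?_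
  obtain ⟨Q, hQ, hQi, hQj⟩ := hp.quartic i
  exact curry_eq_zero_of_mem_relations (t := 8) hv i (hQ.mul hQ) (by simp [hQi])
    fun j hj => .inr (.mul_of_eval (hQj j hj) (hQj j hj))

/-- A relation in degree eight is transverse to the radial direction wherever it is nonzero. -/
lemma curry_ne_smul [CharZero k] (hp : GeneralPoints p) {v : Fin 11 × Fin 3 → k}
    (hv : v ∈ relations p 8) {i : Fin 11} (hi : Function.curry v i ≠ 0) (c : k) :
    Function.curry v i ≠ c • p i := by
  intro h
  obtain ⟨Q, hQ, hQi, hQj⟩ := hp.quartic i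
  have h1 := dirDeriv_eq_zero_of_mem_relations hv i (hQ.mul hQ)
    fun j hj => .inr (.mul_of_eval (hQj j hj) (hQj j hj))
  rw [h, dirDeriv_smul_left, dirDeriv_self (hQ.mul hQ)] at h1
  have hc : c = 0 := by simpa [hQi] using h1
  exact hi (by rw [h, hc, zero_smul])

lemma exists_line_of_relation [CharZero k] (hp : GeneralPoints p) {v : Fin 11 × Fin 3 → k}
    (hv : v ∈ relations p 8) {o : Fin 11} (ho : Function.curry v o ≠ 0) :
    ∃ a : Fin 3 → k, a ≠ 0 ∧ ∃ L : Finset (Fin 11), L.card = 5 ∧ ∀ i ∈ L, a ⬝ᵥ p i = 0 := by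
  obtain ⟨b, hbo, hbv⟩ := exists_dotProduct_separating (x := Function.curry v o) (y := p o)
    fun h => by
      obtain ⟨c, hc⟩ := Submodule.mem_span_singleton.mp h
      exact hp.curry_ne_smul hv ho c hc.symm
  choose Q hQ hQi hQj using hp.quartic
  refine exists_line_of_tangent hp.ne_zero hp.separated hp.cubic hbo hbv
    (c := fun i => dirDeriv (Function.curry v o) (p o) (Q i) / eval (p i) (Q i)) fun F hF => ?_
  set G := F - ∑ i, (eval (p i) F / eval (p i) (Q i)) • Q i with hG
  have hGhom : G.IsHomogeneous 4 := hF.sub (IsHomogeneous.sum _ _ _ fun i _ =>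
    Submodule.smul_mem (homogeneousSubmodule (Fin 3) k 4) _ (hQ i))
  have hGeval : ∀ j, eval (p j) G = 0 := fun j => by
    rw [hG, map_sub, map_sum, Finset.sum_eq_single j _ (by simp)]
    · simp [hQi j]
    · intro i _ hi
      simp [hQj i j hi.symm]
  have h1 := dirDeriv_eq_zero_of_mem_relations hv o ((hQ o).mul hGhom)
    fun j hj => .inr (.mul_of_eval (hQj o j hj) (hGeval j))
  rw [dirDeriv_mul, hGeval, zero_mul, add_zero] at h1
  have h2 := (mul_eq_zero.mp h1).resolve_left (hQi o)
  rw [hG, map_sub, map_sum, sub_eq_zero] at h2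
  rw [h2]
  refine Finset.sum_congr rfl fun i _ => ?_
  rw [map_smul, smul_eq_mul]
  ring

lemma relations_eight [CharZero k] (hp : GeneralPoints p)
    (h : ¬ ∃ a : Fin 3 → k, a ≠ 0 ∧ ∃ L : Finset (Fin 11), L.card = 5 ∧ ∀ i ∈ L, a ⬝ᵥ p i = 0) :
    relations p 8 = ⊥ :=
  (Submodule.eq_bot_iff _).mpr fun _ hv => eq_zero_of_curry fun _ =>
    by_contra fun hi => h (hp.exists_line_of_relation hv hi)

section FiveCollinear

variable {a : Fin 3 → k} {L : Finset (Fin 11)}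

/-- A point off a line containing five of the points is separated from the points off that line
by a conic. -/
lemma exists_conic (hp : GeneralPoints p) (ha : a ≠ 0) (hL : L.card = 5)
    (haL : ∀ i ∈ L, a ⬝ᵥ p i = 0) {y : Fin 11} (hy : y ∉ L) :
    a ⬝ᵥ p y ≠ 0 ∧ ∃ q : MvPolynomial (Fin 3) k, q.IsHomogeneous 2 ∧ eval (p y) q ≠ 0 ∧
      ∀ j ∉ L, j ≠ y → eval (p j) q = 0 := by
  let Φ : homogeneousSubmodule (Fin 3) k 2 →ₗ[k] (↥(Lᶜ.erase y) → k) :=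
    LinearMap.pi fun j =>
      (aeval (p j) : MvPolynomial (Fin 3) k →ₐ[k] k).toLinearMap.domRestrict _
  have hcard : (Lᶜ.erase y).card = 5 := by
    rw [Finset.card_erase_of_mem (by simpa using hy), Finset.card_compl, hL, Fintype.card_fin]
  obtain ⟨q, hqker, hq0⟩ := Submodule.exists_mem_ne_zero_of_ne_bot
    (LinearMap.ker_ne_bot_of_finrank_lt (f := Φ) (by
      rw [finrank_homogeneousSubmodule, Module.finrank_fintype_fun_eq_card, Fintype.card_coe, hcard]
      decide))
  have hq : ∀ j ∉ L, j ≠ y → eval (p j) q.1 = 0 := fun j hj hjy => by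
    simpa [Φ] using congrFun (LinearMap.mem_ker.mp hqker) ⟨j, by simp [hj, hjy]⟩
  have hne : eval (p y) (linForm a * q.1) ≠ 0 := fun h => by
    refine mul_ne_zero (linForm_ne_zero ha) (fun h' => hq0 (Subtype.ext h'))
      (hp.cubic _ ((linForm_isHomogeneous a).mul q.2) fun i => ?_)
    by_cases hi : i ∈ L
    · simp [haL i hi]
    · by_cases hiy : i = y
      · rwa [hiy]
      · simp [hq i hi hiy]
  rw [map_mul, eval_linForm] at hne
  exact ⟨left_ne_zero_of_mul hne, q.1, q.2, right_ne_zero_of_mul hne, hq⟩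

lemma curry_eq_zero_of_notMem [CharZero k] (hp : GeneralPoints p) (ha : a ≠ 0) (hL : L.card = 5)
    (haL : ∀ i ∈ L, a ⬝ᵥ p i = 0) {e : ℕ} {v : Fin 11 × Fin 3 → k}
    (hv : v ∈ relations p (6 + e + 1)) {y : Fin 11} (hy : y ∉ L) : Function.curry v y = 0 := by
  obtain ⟨hay, q, hq, hqy, hqj⟩ := hp.exists_conic ha hL haL hy
  obtain ⟨n, hn⟩ := exists_dotProduct_ne_zero_of_ne (hp.ne_zero y)
  have hal := linForm_isHomogeneous a
  have hg : (linForm a * linForm a * (q * q) * linForm n ^ e).IsHomogeneous (6 + e) :=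
    isHomogeneous_of_eq (((hal.mul hal).mul (hq.mul hq)).mul ((linForm_isHomogeneous n).pow e))
      (by omega)
  refine curry_eq_zero_of_mem_relations hv y hg (by simp [hay, hqy, hn])
    fun j hj => .inr (.mul_right ?_ _)
  · by_cases hjL : j ∈ L
    · have := haL j hjL
      exact .mul_right (.mul_of_eval (by simpa) (by simpa)) _
    · exact .mul_left (.mul_of_eval (hqj j hjL hj) (hqj j hjL hj)) _

lemma dotProduct_curry_eq_zero [CharZero k] (hp : GeneralPoints p) (ha : a ≠ 0) (hL : L.card = 5)
    (haL : ∀ i ∈ L, a ⬝ᵥ p i = 0) {e : ℕ} {v : Fin 11 × Fin 3 → k}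
    (hv : v ∈ relations p (6 + e + 1)) (i : Fin 11) : a ⬝ᵥ Function.curry v i = 0 := by
  by_cases hi : i ∈ L
  swap
  · rw [hp.curry_eq_zero_of_notMem ha hL haL hv hi, dotProduct_zero]
  obtain ⟨Q, hQ, hQi, hQj⟩ := hp.quartic i
  obtain ⟨n, hn⟩ := exists_dotProduct_ne_zero_of_ne (hp.ne_zero i)
  have h := dirDeriv_eq_zero_of_mem_relations hv i
    (isHomogeneous_of_eq ((linForm_isHomogeneous a).mul
      (hQ.mul ((linForm_isHomogeneous n).pow (2 + e)))) (by omega)) fun j hj => ?_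
  · rw [dirDeriv_mul, dirDeriv_linForm, eval_linForm, haL i hi, zero_mul, zero_add] at h
    simpa [hQi, hn] using h
  · by_cases hjL : j ∈ L
    · exact .inr (.mul_of_eval (by simpa using haL j hjL) (by simp [hQj j hj]))
    · exact .inl (hp.curry_eq_zero_of_notMem ha hL haL hv hjL)

/-- Relations in degree at least seven are determined by their component at any one of the five
collinear points. -/
lemma eq_zero_of_curry_eq_zero [CharZero k] (hp : GeneralPoints p) (ha : a ≠ 0) (hL : L.card = 5)
    (haL : ∀ i ∈ L, a ⬝ᵥ p i = 0) {e : ℕ} {v : Fin 11 × Fin 3 → k}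
    (hv : v ∈ relations p (6 + e + 1)) {o : Fin 11} (hoL : o ∈ L)
    (ho : Function.curry v o = 0) : v = 0 := by
  refine eq_zero_of_curry fun i => ?_
  by_cases hi : i ∈ L
  swap
  · exact hp.curry_eq_zero_of_notMem ha hL haL hv hi
  by_cases hio : i = o
  · rwa [hio]
  have hm : ∀ j, ∃ m : Fin 3 → k, j ≠ i → m ⬝ᵥ p j = 0 ∧ m ⬝ᵥ p i ≠ 0 := fun j => by
    by_cases h : j = i
    · exact ⟨0, fun h' => absurd h h'⟩
    · obtain ⟨m, hm⟩ := hp.separated i j (Ne.symm h)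
      exact ⟨m, fun _ => hm⟩
  choose m hm using hm
  obtain ⟨n, hn⟩ := exists_dotProduct_ne_zero_of_ne (hp.ne_zero i)
  set S := (L.erase o).erase i with hS
  have hScard : S.card = 3 := by
    rw [hS, Finset.card_erase_of_mem (by simp [hio, hi]), Finset.card_erase_of_mem hoL, hL]
  have h1 := IsHomogeneous.prod S (fun j => linForm (m j)) (fun _ => 1)
    fun j _ => linForm_isHomogeneous (m j)
  have hprod : ∀ j ∈ S, eval (p j) (∏ j ∈ S, linForm (m j)) = 0 := fun j hj => by
    rw [map_prod, Finset.prod_eq_zero hj]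
    simpa using (hm j (Finset.ne_of_mem_erase hj)).1
  have hne : eval (p i) (∏ j ∈ S, linForm (m j)) ≠ 0 := by
    rw [map_prod]
    exact Finset.prod_ne_zero_iff.mpr fun j hj => by
      simpa using (hm j (Finset.ne_of_mem_erase hj)).2
  have hg : ((∏ j ∈ S, linForm (m j)) * (∏ j ∈ S, linForm (m j)) *
      linForm n ^ e).IsHomogeneous (6 + e) :=
    isHomogeneous_of_eq ((h1.mul h1).mul ((linForm_isHomogeneous n).pow e)) (by simp [hScard])
  have hgi : eval (p i) ((∏ j ∈ S, linForm (m j)) * (∏ j ∈ S, linForm (m j)) *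
      linForm n ^ e) ≠ 0 := by
    rw [map_mul, map_mul]
    exact mul_ne_zero (mul_ne_zero hne hne) (by simp [hn])
  refine curry_eq_zero_of_mem_relations hv i hg hgi fun j hj => ?_
  · by_cases hjL : j ∈ L
    · by_cases hjo : j = o
      · exact .inl (hjo ▸ ho)
      · have hjS : j ∈ S := by simp [hS, hj, hjo, hjL]
        exact .inr (.mul_right (.mul_of_eval (hprod j hjS) (hprod j hjS)) _)
    · exact .inl (hp.curry_eq_zero_of_notMem ha hL haL hv hjL)

lemma finrank_relations_of_line [CharZero k] (hp : GeneralPoints p) (ha : a ≠ 0) (hL : L.card = 5)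
    (haL : ∀ i ∈ L, a ⬝ᵥ p i = 0) :
    Module.finrank k (relations p 7) ≤ 2 ∧ Module.finrank k (relations p 8) ≤ 1 := by
  obtain ⟨o, ho⟩ : L.Nonempty := Finset.card_pos.mp (by omega)
  let W := LinearMap.ker (dotProductEquiv k (Fin 3) a)
  have hW : Module.finrank k W = 2 := by
    have := Module.Dual.finrank_ker_add_one_of_ne_zero (f := dotProductEquiv k (Fin 3) a)
      (by simpa using ha)
    rw [Module.finrank_fintype_fun_eq_card, Fintype.card_fin] at this
    exact Nat.add_right_cancel this
  have hρ : ∀ e, ∃ ρ : relations p (6 + e + 1) →ₗ[k] W, Function.Injective ρ ∧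
      ∀ v, (ρ v : Fin 3 → k) = Function.curry v.1 o := fun e => by
    let ρ := (LinearMap.funLeft k k (fun b : Fin 3 => (o, b))).domRestrict
      (relations p (6 + e + 1))
    refine ⟨ρ.codRestrict W fun v => hp.dotProduct_curry_eq_zero ha hL haL v.2 o, ?_, fun v => rfl⟩
    rw [← LinearMap.ker_eq_bot, LinearMap.ker_eq_bot']
    exact fun v hv => Subtype.ext
      (hp.eq_zero_of_curry_eq_zero ha hL haL v.2 ho (congrArg Subtype.val hv))
  constructor
  · obtain ⟨ρ, hinj, -⟩ := hρ 0
    exact (LinearMap.finrank_le_finrank_of_injective hinj).trans hW.le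
  · obtain ⟨ρ, hinj, hval⟩ := hρ 1
    have hle := LinearMap.finrank_le_finrank_of_injective hinj
    refine Nat.lt_succ_iff.mp (lt_of_le_of_ne (hle.trans hW.le) fun heq => ?_)
    obtain ⟨v, hv⟩ := (LinearMap.injective_iff_surjective_of_finrank_eq_finrank
      (heq.trans hW.symm)).mp hinj ⟨p o, haL o ho⟩
    have hvo : Function.curry v.1 o = p o := by rw [← hval, hv]
    exact hp.curry_ne_smul v.2 (hvo ▸ hp.ne_zero o) 1 (by rw [hvo, one_smul])

end FiveCollinear

end GeneralPoints

section HilbertFunctions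

variable {k : Type} [Field k]

lemma inf_homogeneousSubmodule_doubleIdealOfPoints {s : ℕ}
    (P : Fin s → Projectivization k (Fin 3 → k)) (t : ℕ) :
    Submodule.restrictScalars k (doubleIdealOfPoints k P) ⊓ homogeneousSubmodule (Fin 3) k t =
      singularForms (fun i => (P i).rep) t := by
  ext F
  simp only [Submodule.mem_inf, Submodule.restrictScalars_mem, doubleIdealOfPoints,
    Ideal.mem_iInf, mem_homogeneousSubmodule, mem_singularForms]
  exact ⟨fun h => ⟨h.2, fun i => singularAt_of_mem_sq (h.1 i)⟩,
    fun h => ⟨fun i => mem_sq_of_singularAt h.1 (h.2 i), h.1⟩⟩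

lemma hilbertFunction_doubleIdealOfPoints {s : ℕ}
    (P : Fin s → Projectivization k (Fin 3 → k)) (t : ℕ) :
    hilbertFunction k (doubleIdealOfPoints k P) t =
      (t + 2).choose 2 - Module.finrank k (singularForms (fun i => (P i).rep) t) := by
  rw [hilbertFunction, inf_homogeneousSubmodule_doubleIdealOfPoints, finrank_homogeneousSubmodule]

lemma mem_idealOfPoints {s : ℕ} {P : Fin s → Projectivization k (Fin 3 → k)} {t : ℕ}
    {F : MvPolynomial (Fin 3) k} (hF : F.IsHomogeneous t) (h : ∀ i, eval (P i).rep F = 0) :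
    F ∈ idealOfPoints k P :=
  Ideal.mem_iInf.mpr fun i => mem_pointIdeal_of_eval hF (h i)

/-- The value `H_X(t)` is at most the rank of the evaluation of forms of degree `t` at `X`. -/
lemma hilbertFunction_idealOfPoints_le {s : ℕ} (P : Fin s → Projectivization k (Fin 3 → k))
    {t : ℕ} (Φ : homogeneousSubmodule (Fin 3) k t →ₗ[k] (Fin s → k))
    (hΦ : ∀ F i, Φ F i = eval (P i).rep F.1) :
    hilbertFunction k (idealOfPoints k P) t ≤ Module.finrank k (LinearMap.range Φ) := by
  have h1 := LinearMap.finrank_range_add_finrank_ker Φ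
  have h2 : Module.finrank k ((LinearMap.ker Φ).map (Submodule.subtype _)) ≤
      Module.finrank k ↥(Submodule.restrictScalars k (idealOfPoints k P) ⊓
        homogeneousSubmodule (Fin 3) k t) := by
    have : FiniteDimensional k ↥(Submodule.restrictScalars k (idealOfPoints k P) ⊓
        homogeneousSubmodule (Fin 3) k t) := Submodule.finiteDimensional_of_le inf_le_right
    refine Submodule.finrank_mono ?_
    rintro _ ⟨F, hF, rfl⟩
    exact ⟨mem_idealOfPoints F.2 fun i => (hΦ F i).symm.trans (congrFun hF i), F.2⟩
  rw [Submodule.finrank_map_subtype_eq] at h2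
  rw [hilbertFunction]
  omega

lemma generalPoints_of_hasGenericHilbertFunction {P : Fin 11 → Projectivization k (Fin 3 → k)}
    (hinj : Function.Injective P) (hgen : HasGenericHilbertFunction k P) :
    GeneralPoints fun i => (P i).rep where
  ne_zero i := (P i).rep_nonzero
  separated i j hij := exists_dotProduct_separating fun h => by
    obtain ⟨c, hc⟩ := Submodule.mem_span_singleton.mp h
    refine hij (hinj ?_)
    rw [← (P i).mk_rep, ← (P j).mk_rep]
    exact (Projectivization.mk_eq_mk_iff' k _ _ _ _).mpr ⟨c, hc⟩
  cubic F hF h := by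
    have h3 : hilbertFunction k (idealOfPoints k P) 3 = 10 := hgen 3
    have : FiniteDimensional k ↥(Submodule.restrictScalars k (idealOfPoints k P) ⊓
        homogeneousSubmodule (Fin 3) k 3) := Submodule.finiteDimensional_of_le inf_le_right
    have hbot : Submodule.restrictScalars k (idealOfPoints k P) ⊓
        homogeneousSubmodule (Fin 3) k 3 = ⊥ := by
      have h10 : Nat.choose (3 + 2) 2 = 10 := rfl
      rw [hilbertFunction, finrank_homogeneousSubmodule, h10] at h3
      exact Submodule.finrank_eq_zero.mp (by omega)
    exact (Submodule.mem_bot k).mp (hbot ▸ ⟨mem_idealOfPoints hF h, hF⟩)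
  quartic i := by
    let Φ : homogeneousSubmodule (Fin 3) k 4 →ₗ[k] (Fin 11 → k) := LinearMap.pi fun i =>
      (aeval (P i).rep : MvPolynomial (Fin 3) k →ₐ[k] k).toLinearMap.domRestrict _
    have hΦ : ∀ F i, Φ F i = eval (P i).rep F.1 := fun _ _ => rfl
    have h4 : 11 ≤ Module.finrank k (LinearMap.range Φ) :=
      (hgen 4).symm.trans_le (hilbertFunction_idealOfPoints_le P Φ hΦ)
    have hsurj : LinearMap.range Φ = ⊤ := Submodule.eq_top_of_finrank_eq
      (le_antisymm (Submodule.finrank_le _) (by simpa using h4))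
    obtain ⟨Q, hQ⟩ := LinearMap.range_eq_top.mp hsurj (Pi.single i 1)
    exact ⟨Q.1, Q.2, by simp [← hΦ, hQ], fun j hj => by simp [← hΦ, hQ, hj]⟩

end HilbertFunctions

/-- For 11 points of ℙ² with generic Hilbert function, if H_{2X}(6) = 28 then
H_{2X}(7) ≥ 31, H_{2X}(8) ≥ 32 and H_{2X}(9) ≥ 33. -/
theorem statement3 (k : Type) [Field k] [IsAlgClosed k] [CharZero k]
    (P : Fin 11 → Projectivization k (Fin 3 → k)) (hinj : Function.Injective P)
    (hgen : HasGenericHilbertFunction k P)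
    (h6 : hilbertFunction k (doubleIdealOfPoints k P) 6 = 28) :
    31 ≤ hilbertFunction k (doubleIdealOfPoints k P) 7 ∧
    32 ≤ hilbertFunction k (doubleIdealOfPoints k P) 8 ∧
    33 ≤ hilbertFunction k (doubleIdealOfPoints k P) 9 := by
  have hp := generalPoints_of_hasGenericHilbertFunction hinj hgen
  simp only [hilbertFunction_doubleIdealOfPoints] at h6 ⊢
  generalize (fun i => (P i).rep) = p at hp h6 ⊢
  have c6 : Nat.choose (6 + 2) 2 = 28 := rfl
  have c7 : Nat.choose (7 + 2) 2 = 36 := rfl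
  have c8 : Nat.choose (8 + 2) 2 = 45 := rfl
  have c9 : Nat.choose (9 + 2) 2 = 55 := rfl
  have e7 := finrank_relations p (t := 7) (by decide)
  have e8 := finrank_relations p (t := 8) (by decide)
  have e9 := finrank_relations p (t := 9) (by decide)
  rw [hp.relations_nine, finrank_bot] at e9
  by_cases hline : ∃ a : Fin 3 → k, a ≠ 0 ∧
      ∃ L : Finset (Fin 11), L.card = 5 ∧ ∀ i ∈ L, a ⬝ᵥ p i = 0
  · obtain ⟨a, ha, L, hL, haL⟩ := hline
    obtain ⟨r7, r8⟩ := hp.finrank_relations_of_line ha hL haL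
    omega
  · rw [hp.relations_eight hline, finrank_bot] at e8
    have h0 : singularForms p 6 = ⊥ := Submodule.finrank_eq_zero.mp (by omega)
    have hlt : Module.finrank k (singularForms p 7) = 0 ∨
        2 * Module.finrank k (singularForms p 7) < Module.finrank k (singularForms p 8) := by
      by_cases h1 : singularForms p 7 = ⊥
      · exact .inl (by rw [h1, finrank_bot])
      · exact .inr (two_mul_finrank_singularForms_lt hp.ne_zero h0 h1)
    omega
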